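/- The generating function for the total number of hooks of length 2 in all ℓ-regular partitions of n satisfies ∑_{n≥0} b_{ℓ,2}(n) q^n = ((q^ℓ;q^ℓ)_∞/(q;q)_∞) · (2q^2/(1-q^2) - q^ℓ/(1-q^ℓ) + (q^{2ℓ-1}-q^{2ℓ}+q^{2ℓ+1})/(1-q^{2ℓ})) as formal power series. -/

import Mathlib

open PowerSeries

/-- The `i`-th largest part (0-indexed) of a partition, or `0` if `i` is too large. -/
def partAt {n : ℕ} (p : Nat.Partition n) (i : ℕ) : ℕ :=
  ((p.parts.sort (· ≤ ·)).reverse).getD i 0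

/-- The number of parts of `p` exceeding `j`, i.e. the `j`-th column length (0-indexed). -/
def colAt {n : ℕ} (p : Nat.Partition n) (j : ℕ) : ℕ :=
  (p.parts.filter (fun a => j < a)).card

/-- The number of cells in the Young diagram of `p` whose hook length equals `t`.
The cell in row `i`, column `j` (0-indexed) has hook length
`(λᵢ - 1 - j) + (λ'ⱼ - 1 - i) + 1`. -/
def hookCount {n : ℕ} (p : Nat.Partition n) (t : ℕ) : ℕ :=
  ((Finset.range n ×ˢ Finset.range n).filter
    (fun ij => ij.2 < partAt p ij.1 ∧
      (partAt p ij.1 - ij.2) + (colAt p ij.2 - ij.1) - 1 = t)).card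

/-- `bCount ℓ t n` is the total number of hooks of length `t` over all `ℓ`-regular
partitions of `n` (partitions with no part divisible by `ℓ`). -/
def bCount (ℓ t n : ℕ) : ℕ :=
  ∑ p ∈ Finset.univ.filter (fun p : Nat.Partition n => ∀ a ∈ p.parts, ¬ ℓ ∣ a),
    hookCount p t

noncomputable instance : TopologicalSpace (PowerSeries ℚ) :=
  inferInstanceAs (TopologicalSpace ((Unit →₀ ℕ) → ℚ))

section GeneratingFunction

open scoped PowerSeries.WithPiTopology

/-- The generating function of `ℓ`-regular partitions, as a quotient of infinite products. -/
theorem mk_card_restricted_not_dvd_eq_tprod_mul_inv (K : Type*) [Field K] [TopologicalSpace K]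
    [T2Space K] [IsTopologicalRing K] {ℓ : ℕ} (hℓ : 0 < ℓ) :
    (PowerSeries.mk fun n => ((Nat.Partition.restricted n (¬ ℓ ∣ ·)).card : K)) =
      (∏' j : ℕ, (1 - (X : K⟦X⟧) ^ (ℓ * (j + 1)))) *
        (∏' j : ℕ, (1 - (X : K⟦X⟧) ^ (j + 1)))⁻¹ := by
  have hc : constantCoeff (∏' j : ℕ, (1 - (X : K⟦X⟧) ^ (j + 1))) ≠ 0 := by
    rw [(WithPiTopology.multipliable_one_sub_X_pow K).map_tprod _
      (WithPiTopology.continuous_constantCoeff K)]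
    simp
  rw [PowerSeries.eq_mul_inv_iff_mul_eq hc,
    Nat.Partition.powerSeriesMk_card_restricted_eq_powerSeriesMk_card_countRestricted K hℓ,
    Nat.Partition.powerSeriesMk_card_countRestricted_eq_tprod K hℓ,
    ← (Nat.Partition.multipliable_powerSeriesMk_card_countRestricted K ℓ).tprod_mul
      (WithPiTopology.multipliable_one_sub_X_pow K)]
  exact tprod_congr fun i => by simp_rw [mul_comm ℓ, pow_mul, geom_sum_mul_neg]

end GeneratingFunction

/-- Removing the parts in `s` is a bijection from the partitions of `n` that contain `s`
onto the partitions of `n - s.sum`. -/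
theorem card_filter_le_parts (P : ℕ → Prop) [DecidablePred P] (n : ℕ) (s : Multiset ℕ)
    (hs : ∀ x ∈ s, 0 < x ∧ P x) :
    ((Nat.Partition.restricted n P).filter (s ≤ ·.parts)).card =
      if s.sum ≤ n then (Nat.Partition.restricted (n - s.sum) P).card else 0 := by
  split_ifs with h
  · refine Finset.card_bij'
      (fun p hp => ⟨p.parts - s,
        fun hi => p.parts_pos (Multiset.mem_of_le (Multiset.sub_le_self _ _) hi), ?_⟩)
      (fun p _ => ⟨p.parts + s, fun hi => ?_, ?_⟩) ?_ ?_ ?_ ?_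
    · have hle := (Finset.mem_filter.1 hp).2
      have := congrArg Multiset.sum (tsub_add_cancel_of_le hle)
      rw [Multiset.sum_add, p.parts_sum] at this
      omega
    · rcases Multiset.mem_add.1 hi with hi | hi
      exacts [p.parts_pos hi, (hs _ hi).1]
    · rw [Multiset.sum_add, p.parts_sum]; omega
    · intro p hp
      simp only [Nat.Partition.restricted, Finset.mem_filter, Finset.mem_univ, true_and] at hp ⊢
      exact fun i hi => hp.1 i (Multiset.mem_of_le (Multiset.sub_le_self _ _) hi)
    · intro p hp
      simp only [Nat.Partition.restricted, Finset.mem_filter, Finset.mem_univ, true_and] at hp ⊢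
      refine ⟨fun i hi => ?_, Multiset.le_add_left _ _⟩
      rcases Multiset.mem_add.1 hi with hi | hi
      exacts [hp i hi, (hs _ hi).2]
    · intro p hp
      ext1
      exact tsub_add_cancel_of_le (Finset.mem_filter.1 hp).2
    · intro p hp
      ext1
      exact add_tsub_cancel_right _ _
  · refine Finset.card_eq_zero.2 (Finset.filter_eq_empty_iff.2 fun p _ hle => h ?_)
    have := congrArg Multiset.sum (tsub_add_cancel_of_le hle)
    rw [Multiset.sum_add, p.parts_sum] at this
    omega

/-- The generating function of the `ℓ`-regular partitions containing `s`. -/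
theorem sum_restricted_ite_le_parts {ℓ : ℕ} (n : ℕ) (s : Multiset ℕ) :
    (∑ p ∈ Nat.Partition.restricted n (¬ ℓ ∣ ·), if s ≤ p.parts then 1 else 0 : ℚ) =
      if ∀ x ∈ s, ¬ ℓ ∣ x then
        coeff n ((PowerSeries.mk fun n =>
          ((Nat.Partition.restricted n (¬ ℓ ∣ ·)).card : ℚ)) * X ^ s.sum) else 0 := by
  rw [← Finset.natCast_card_filter]
  split_ifs with h
  · rw [card_filter_le_parts _ _ _ fun x hx =>
      ⟨Nat.pos_of_ne_zero fun h0 => h x hx (h0 ▸ dvd_zero ℓ), h x hx⟩, coeff_mul_X_pow']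
    split_ifs <;> simp
  · rw [Nat.cast_eq_zero, Finset.card_eq_zero]
    refine Finset.filter_eq_empty_iff.2 fun p hp hle => h fun x hx => ?_
    simp only [Nat.Partition.restricted, Finset.mem_filter] at hp
    exact hp.2 x (Multiset.mem_of_le hle hx)

theorem List.lt_getD_iff_lt_length_filter {L : List ℕ} (hL : L.Pairwise (· ≥ ·)) (i j : ℕ) :
    j < L.getD i 0 ↔ i < (L.filter (j < ·)).length := by
  induction L generalizing i with
  | nil => simp
  | cons x L ih =>
    rw [List.pairwise_cons] at hL
    by_cases hx : j < x
    · cases i with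
      | zero => simp [hx]
      | succ i => simpa [hx] using ih hL.2 i
    · have hnil : L.filter (j < ·) = [] := by
        simp only [List.filter_eq_nil_iff, decide_eq_true_eq]
        intro a ha
        have := hL.1 a ha
        omega
      cases i with
      | zero => simp [hx, hnil]
      | succ i =>
        have := ih hL.2 i
        rw [hnil] at this
        rw [List.filter_cons_of_neg (by simpa using hx), hnil, List.getD_cons_succ, this]
        simp

theorem lt_partAt_iff_lt_colAt {n : ℕ} (p : Nat.Partition n) (i j : ℕ) :
    j < partAt p i ↔ i < colAt p j := by
  have hL : (p.parts.sort (· ≤ ·)).reverse.Pairwise (· ≥ ·) :=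
    List.pairwise_reverse.2 (p.parts.pairwise_sort (· ≤ ·))
  rw [partAt, List.lt_getD_iff_lt_length_filter hL, colAt, List.filter_reverse,
    List.length_reverse]
  conv_rhs => rw [← p.parts.sort_eq (· ≤ ·), Multiset.filter_coe, Multiset.coe_card]

theorem colAt_eq_colAt_succ_add_count {n : ℕ} (p : Nat.Partition n) (j : ℕ) :
    colAt p j = colAt p (j + 1) + p.parts.count (j + 1) := by
  simp only [colAt, ← Multiset.countP_eq_card_filter, Multiset.count]
  induction p.parts using Multiset.induction_on with
  | empty => simp
  | cons a s ih =>
    simp only [Multiset.countP_cons, ih]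
    split_ifs <;> omega

theorem colAt_le {n : ℕ} (p : Nat.Partition n) (j : ℕ) : colAt p j ≤ n := by
  refine (Multiset.card_le_card (Multiset.filter_le _ _)).trans ?_
  have := Multiset.card_nsmul_le_sum (s := p.parts) (a := 1) fun x hx => p.parts_pos hx
  simpa [p.parts_sum] using this

theorem colAt_self {n : ℕ} (p : Nat.Partition n) {j : ℕ} (hj : n ≤ j) : colAt p j = 0 := by
  rw [colAt, Multiset.card_eq_zero, Multiset.filter_eq_nil]
  intro a ha
  have := p.le_of_mem_parts ha
  omega

/-- A hook of length two is a horizontal domino at the end of the last row of length `a`, where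
`a - 1` is not a part, or a vertical domino at the end of the last two rows of length `a`. -/
theorem hookCount_two {n : ℕ} (p : Nat.Partition n) :
    hookCount p 2 =
      ((Finset.range (n + 1)).filter
        fun a => 2 ≤ a ∧ 0 < p.parts.count a ∧ p.parts.count (a - 1) = 0).card +
      ((Finset.range (n + 1)).filter fun a => 0 < a ∧ 2 ≤ p.parts.count a).card := by
  have key := lt_partAt_iff_lt_colAt p
  have col := colAt_eq_colAt_succ_add_count p
  have le := colAt_le p
  have big : ∀ j, 0 < colAt p j → j < n := fun j hj => by
    by_contra! h
    rw [colAt_self p h] at hj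
    exact hj.false
  rw [hookCount, ← Finset.card_filter_add_card_filter_not (fun ij => partAt p ij.1 = ij.2 + 2)]
  simp only [Finset.filter_filter]
  congr 1
  · refine Finset.card_bij' (fun ij _ => ij.2 + 2) (fun a _ => (colAt p (a - 1) - 1, a - 2))
      ?_ ?_ ?_ ?_
    · rintro ⟨i, j⟩ h
      simp only [Finset.mem_filter, Finset.mem_product, Finset.mem_range] at h ⊢
      have h0 := key i j
      have h1 := key i (j + 1)
      have h2 := key i (j + 2)
      have c1 := col j
      have c2 := col (j + 1)
      have b := big (j + 1)
      simp only [show j + 2 - 1 = j + 1 by omega, add_assoc, Nat.reduceAdd] at *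
      omega
    · intro a h
      simp only [Finset.mem_filter, Finset.mem_product, Finset.mem_range] at h ⊢
      obtain ⟨j, rfl⟩ := Nat.exists_eq_add_of_le' h.2.1
      have c1 := col j
      have c2 := col (j + 1)
      simp only [Nat.add_sub_cancel, show j + 2 - 1 = j + 1 by omega, add_assoc, Nat.reduceAdd] at *
      have h0 := key (colAt p (j + 1) - 1) j
      have h1 := key (colAt p (j + 1) - 1) (j + 1)
      have h2 := key (colAt p (j + 1) - 1) (j + 2)
      have l := le (j + 1)
      omega
    · rintro ⟨i, j⟩ h
      simp only [Finset.mem_filter, Finset.mem_product, Finset.mem_range] at h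
      have h0 := key i j
      have h1 := key i (j + 1)
      have c1 := col j
      simp only [Nat.add_sub_cancel, show j + 2 - 1 = j + 1 by omega, Prod.mk.injEq, and_true] at *
      omega
    · intro a h
      simp only [Finset.mem_filter] at h
      omega
  · refine Finset.card_bij' (fun ij _ => ij.2 + 1) (fun a _ => (colAt p (a - 1) - 2, a - 1))
      ?_ ?_ ?_ ?_
    · rintro ⟨i, j⟩ h
      simp only [Finset.mem_filter, Finset.mem_product, Finset.mem_range] at h ⊢
      have h0 := key i j
      have h1 := key i (j + 1)
      have c1 := col j
      omega
    · intro a h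
      simp only [Finset.mem_filter, Finset.mem_product, Finset.mem_range] at h ⊢
      obtain ⟨j, rfl⟩ : ∃ j, a = j + 1 := ⟨a - 1, by omega⟩
      have c1 := col j
      simp only [Nat.add_sub_cancel] at *
      have h0 := key (colAt p j - 2) j
      have h1 := key (colAt p j - 2) (j + 1)
      have l := le j
      omega
    · rintro ⟨i, j⟩ h
      simp only [Finset.mem_filter, Finset.mem_product, Finset.mem_range] at h
      have h0 := key i j
      simp only [Nat.add_sub_cancel, Prod.mk.injEq, and_true]
      omega
    · intro a h
      simp only [Finset.mem_filter] at h
      omega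

/-- Inclusion-exclusion form of `hookCount_two`. -/
theorem natCast_hookCount_two {n : ℕ} (p : Nat.Partition n) :
    (hookCount p 2 : ℚ) = ∑ a ∈ Finset.range (n + 1),
      ((if 2 ≤ a then (if {a} ≤ p.parts then 1 else 0) -
          (if {a, a - 1} ≤ p.parts then 1 else 0) else 0) +
        if {a, a} ≤ p.parts then 1 else 0) := by
  have h0 : p.parts.count 0 = 0 := Multiset.count_eq_zero.2 fun h => (p.parts_pos h).false
  rw [hookCount_two, Finset.card_filter, Finset.card_filter, ← Finset.sum_add_distrib]
  push_cast
  refine Finset.sum_congr rfl fun a _ => ?_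
  have h1 : {a} ≤ p.parts ↔ 0 < p.parts.count a := by
    rw [Multiset.singleton_le, Multiset.count_pos]
  have h2 : {a, a} ≤ p.parts ↔ 2 ≤ p.parts.count a := by
    rw [Multiset.le_count_iff_replicate_le]; rfl
  have h3 : 2 ≤ a → ({a, a - 1} ≤ p.parts ↔ 0 < p.parts.count a ∧ 0 < p.parts.count (a - 1)) := by
    intro ha
    rw [Multiset.le_iff_subset (by simp; omega)]
    simp [Multiset.count_pos, Multiset.insert_eq_cons, Multiset.cons_subset]
  rcases Nat.eq_zero_or_pos a with rfl | ha
  · simp only [h2, h0]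
    simp
  by_cases ha2 : 2 ≤ a
  · simp only [h1, h2, h3 ha2, ha, ha2]
    by_cases 0 < p.parts.count a <;> by_cases hc : p.parts.count (a - 1) = 0 <;>
      simp_all [Nat.pos_iff_ne_zero]
  · simp only [h2, ha2, ha]
    simp

theorem coeff_X_pow_mul_inv_one_sub_X_pow (K : Type*) [Field K] (c m : ℕ) {d : ℕ} (hd : 0 < d) :
    coeff m (X ^ c * (1 - (X : K⟦X⟧) ^ d)⁻¹) = if c ≤ m ∧ d ∣ m - c then 1 else 0 := by
  have hinv : (1 - (X : K⟦X⟧) ^ d)⁻¹ = PowerSeries.mk fun n => if d ∣ n then 1 else 0 := by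
    rw [eq_comm, PowerSeries.eq_inv_iff_mul_eq_one (by simp [hd.ne'])]
    ext n
    rw [mul_sub, mul_one, map_sub, coeff_mul_X_pow', coeff_one]
    simp only [coeff_mk]
    rcases lt_or_ge n d with h | h
    · rcases Nat.eq_zero_or_pos n with rfl | hn
      · simp [hd.ne']
      · simp [h, hn.ne', Nat.not_dvd_of_pos_of_lt hn h]
    · simp [h, Nat.dvd_sub_iff_left h dvd_rfl, (hd.trans_le h).ne']
  rw [coeff_X_pow_mul', hinv]
  split_ifs <;> simp_all

theorem sum_range_ite_eq_of_even (ℓ : ℕ) {k n : ℕ} (hk : 2 * k ≤ n) :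
    ∑ a ∈ Finset.range (n + 1),
      ((if 2 ≤ a then (if ¬ ℓ ∣ a then if 2 * k = a then (1 : ℚ) else 0 else 0) -
          (if ¬ ℓ ∣ a ∧ ¬ ℓ ∣ a - 1 then if 2 * k = a + (a - 1) then 1 else 0 else 0) else 0) +
        if ¬ ℓ ∣ a then if 2 * k = a + a then 1 else 0 else 0) =
      (if 0 < k ∧ ¬ ℓ ∣ 2 * k then 1 else 0) + (if ¬ ℓ ∣ k then 1 else 0) := by
  calc
    _ = ∑ a ∈ Finset.range (n + 1),
        ((if a = 2 * k then (if 0 < k ∧ ¬ ℓ ∣ 2 * k then (1 : ℚ) else 0) else 0) +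
        (if a = k then (if ¬ ℓ ∣ k then 1 else 0) else 0)) := by
      refine Finset.sum_congr rfl fun a _ => ?_
      have h2 : 2 ≤ a → 2 * k ≠ a + (a - 1) := by omega
      have h3 : 2 * k = a + a ↔ a = k := by omega
      have h4 : 2 * k = a ↔ a = 2 * k := by omega
      simp only [h3, h4]
      congr 1 <;> grind
    _ = _ := by
      simp only [Finset.sum_add_distrib, Finset.sum_ite_eq', Finset.mem_range,
        show 2 * k < n + 1 by omega, show k < n + 1 by omega, if_true]

theorem sum_range_ite_eq_of_odd (ℓ : ℕ) {k n : ℕ} (hk : 2 * k + 1 ≤ n) :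
    ∑ a ∈ Finset.range (n + 1),
      ((if 2 ≤ a then (if ¬ ℓ ∣ a then if 2 * k + 1 = a then (1 : ℚ) else 0 else 0) -
          (if ¬ ℓ ∣ a ∧ ¬ ℓ ∣ a - 1 then if 2 * k + 1 = a + (a - 1) then 1 else 0 else 0) else 0) +
        if ¬ ℓ ∣ a then if 2 * k + 1 = a + a then 1 else 0 else 0) =
      (if 0 < k ∧ ¬ ℓ ∣ 2 * k + 1 then 1 else 0) -
        (if 0 < k ∧ ¬ ℓ ∣ k + 1 ∧ ¬ ℓ ∣ k then 1 else 0) := by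
  calc
    _ = ∑ a ∈ Finset.range (n + 1),
        ((if a = 2 * k + 1 then (if 0 < k ∧ ¬ ℓ ∣ 2 * k + 1 then (1 : ℚ) else 0) else 0) -
        (if a = k + 1 then (if 0 < k ∧ ¬ ℓ ∣ k + 1 ∧ ¬ ℓ ∣ k then 1 else 0) else 0)) := by
      refine Finset.sum_congr rfl fun a _ => ?_
      have h2 : 2 * k + 1 ≠ a + a := by omega
      have h3 : 2 * k + 1 = a + (a - 1) ↔ a = k + 1 := by omega
      have h4 : 2 * k + 1 = a ↔ a = 2 * k + 1 := by omega
      simp only [h2, h3, h4]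
      rcases eq_or_ne a (k + 1) with rfl | ha
      · rw [Nat.add_sub_cancel]
        grind
      · grind
    _ = _ := by
      simp only [Finset.sum_sub_distrib, Finset.sum_ite_eq', Finset.mem_range,
        show 2 * k + 1 < n + 1 by omega, show k + 1 < n + 1 by omega, if_true]

theorem coeff_closed_form {ℓ : ℕ} (m : ℕ) (hℓ : 0 < ℓ) :
    coeff m (2 * X ^ 2 * (1 - (X : ℚ⟦X⟧) ^ 2)⁻¹ - X ^ ℓ * (1 - (X : ℚ⟦X⟧) ^ ℓ)⁻¹ +
          (X ^ (2 * ℓ - 1) - X ^ (2 * ℓ) + X ^ (2 * ℓ + 1)) *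
            (1 - (X : ℚ⟦X⟧) ^ (2 * ℓ))⁻¹) =
      (if 0 < m ∧ 2 ∣ m then 2 else 0) - (if 0 < m ∧ ℓ ∣ m then 1 else 0) +
        ((if 2 * ℓ ∣ m + 1 then 1 else 0) - (if 0 < m ∧ 2 * ℓ ∣ m then 1 else 0) +
          (if 2 ≤ m ∧ 2 * ℓ ∣ m - 1 then 1 else 0)) := by
  have hself : ∀ d, 0 < d → (d ≤ m ∧ d ∣ m - d ↔ 0 < m ∧ d ∣ m) := fun d hd =>
    ⟨fun h => ⟨hd.trans_le h.1, (Nat.dvd_sub_iff_left h.1 dvd_rfl).1 h.2⟩,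
      fun h => ⟨Nat.le_of_dvd h.1 h.2, Nat.dvd_sub h.2 dvd_rfl⟩⟩
  have hpred : 2 * ℓ - 1 ≤ m ∧ 2 * ℓ ∣ m - (2 * ℓ - 1) ↔ 2 * ℓ ∣ m + 1 := by
    constructor
    · rintro ⟨h1, h2⟩
      rw [show m + 1 = m - (2 * ℓ - 1) + 2 * ℓ by omega]
      exact dvd_add h2 dvd_rfl
    · intro h
      have := Nat.le_of_dvd (by omega) h
      refine ⟨by omega, ?_⟩
      rw [show m - (2 * ℓ - 1) = m + 1 - 2 * ℓ by omega]
      exact Nat.dvd_sub h dvd_rfl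
  have hsucc : 2 * ℓ + 1 ≤ m ∧ 2 * ℓ ∣ m - (2 * ℓ + 1) ↔ 2 ≤ m ∧ 2 * ℓ ∣ m - 1 := by
    constructor
    · rintro ⟨h1, h2⟩
      rw [show m - 1 = m - (2 * ℓ + 1) + 2 * ℓ by omega]
      exact ⟨by omega, dvd_add h2 dvd_rfl⟩
    · rintro ⟨h1, h2⟩
      have := Nat.le_of_dvd (by omega) h2
      refine ⟨by omega, ?_⟩
      rw [show m - (2 * ℓ + 1) = m - 1 - 2 * ℓ by omega]
      exact Nat.dvd_sub h2 dvd_rfl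
  rw [mul_assoc, two_mul (X ^ 2 * (1 - (X : ℚ⟦X⟧) ^ 2)⁻¹), add_mul, sub_mul]
  simp only [map_add, map_sub, coeff_X_pow_mul_inv_one_sub_X_pow ℚ _ m Nat.zero_lt_two,
    coeff_X_pow_mul_inv_one_sub_X_pow ℚ _ m hℓ,
    coeff_X_pow_mul_inv_one_sub_X_pow ℚ _ m (show 0 < 2 * ℓ by omega),
    hself 2 Nat.zero_lt_two, hself ℓ hℓ, hself (2 * ℓ) (by omega), hpred, hsucc]
  congr 2
  split_ifs <;> norm_num

/-- The truncated sum over part sizes agrees with the closed form up to degree `n`. -/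
theorem coeff_sum_eq_coeff_closed_form {ℓ m n : ℕ} (hℓ : 2 ≤ ℓ) (hm : m ≤ n) :
    coeff m (∑ a ∈ Finset.range (n + 1),
      ((if 2 ≤ a then (if ¬ ℓ ∣ a then (X : ℚ⟦X⟧) ^ a else 0) -
          (if ¬ ℓ ∣ a ∧ ¬ ℓ ∣ a - 1 then X ^ (a + (a - 1)) else 0) else 0) +
        if ¬ ℓ ∣ a then X ^ (a + a) else 0)) =
    coeff m (2 * X ^ 2 * (1 - (X : ℚ⟦X⟧) ^ 2)⁻¹ - X ^ ℓ * (1 - (X : ℚ⟦X⟧) ^ ℓ)⁻¹ +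
          (X ^ (2 * ℓ - 1) - X ^ (2 * ℓ) + X ^ (2 * ℓ + 1)) *
            (1 - (X : ℚ⟦X⟧) ^ (2 * ℓ))⁻¹) := by
  rw [coeff_closed_form m (by omega)]
  simp only [map_sum, map_add, map_sub, apply_ite (coeff m), coeff_X_pow, map_zero]
  rcases Nat.even_or_odd' m with ⟨k, rfl | rfl⟩
  · rw [sum_range_ite_eq_of_even ℓ hm]
    have e1 : ¬ 2 * ℓ ∣ 2 * k + 1 := fun h => by have := dvd_of_mul_right_dvd h; omega
    have e2 : 2 * ℓ ∣ 2 * k ↔ ℓ ∣ k := Nat.mul_dvd_mul_iff_left Nat.zero_lt_two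
    have e3 : ¬ (2 ≤ 2 * k ∧ 2 * ℓ ∣ 2 * k - 1) := fun ⟨h, h'⟩ => by
      have := dvd_of_mul_right_dvd h'; omega
    rcases Nat.eq_zero_or_pos k with rfl | hk
    · simp [show ℓ ≠ 1 by omega]
    · simp only [e1, e2, e3, hk, show 0 < 2 * k by omega, dvd_mul_right, true_and, if_true,
        if_false]
      by_cases h1 : ℓ ∣ k
      · simp [h1, h1.mul_left 2]
        norm_num
      · by_cases h2 : ℓ ∣ 2 * k <;> simp [h1, h2] <;> norm_num
  · rw [sum_range_ite_eq_of_odd ℓ hm]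
    have e1 : 2 * ℓ ∣ 2 * k + 1 + 1 ↔ ℓ ∣ k + 1 := by
      rw [show 2 * k + 1 + 1 = 2 * (k + 1) by ring, Nat.mul_dvd_mul_iff_left Nat.zero_lt_two]
    have e2 : ¬ 2 * ℓ ∣ 2 * k + 1 := fun h => by have := dvd_of_mul_right_dvd h; omega
    have e3 : 2 ≤ 2 * k + 1 ∧ 2 * ℓ ∣ 2 * k + 1 - 1 ↔ 0 < k ∧ ℓ ∣ k := by
      rw [Nat.add_sub_cancel, Nat.mul_dvd_mul_iff_left Nat.zero_lt_two]
      omega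
    have e4 : ¬ 2 ∣ 2 * k + 1 := by omega
    have e5 : ℓ ∣ k → ¬ ℓ ∣ k + 1 := fun h h' => by
      have := Nat.le_of_dvd one_pos ((Nat.dvd_add_right h).1 h')
      omega
    simp only [e1, e2, e3, e4]
    rcases Nat.eq_zero_or_pos k with rfl | hk
    · simp [show ℓ ≠ 1 by omega]
    · simp only [hk, true_and]
      by_cases h1 : ℓ ∣ k
      · by_cases h2 : ℓ ∣ 2 * k + 1 <;> simp [h1, h2, e5 h1]
      · by_cases h2 : ℓ ∣ 2 * k + 1 <;> by_cases h3 : ℓ ∣ k + 1 <;> simp [h1, h2, h3]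

/-- The contribution of the multisets `{a}`, `{a, a - 1}` and `{a, a}` to the number of hooks of
length two. -/
theorem sum_restricted_ite_le_parts_eq_coeff (ℓ n a : ℕ) :
    (∑ p ∈ Nat.Partition.restricted n (¬ ℓ ∣ ·),
      ((if 2 ≤ a then (if {a} ≤ p.parts then 1 else 0) -
          (if {a, a - 1} ≤ p.parts then 1 else 0) else 0) +
        if {a, a} ≤ p.parts then 1 else 0 : ℚ)) =
      coeff n ((PowerSeries.mk fun n =>
          ((Nat.Partition.restricted n (¬ ℓ ∣ ·)).card : ℚ)) *
        ((if 2 ≤ a then (if ¬ ℓ ∣ a then (X : ℚ⟦X⟧) ^ a else 0) -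
            (if ¬ ℓ ∣ a ∧ ¬ ℓ ∣ a - 1 then X ^ (a + (a - 1)) else 0) else 0) +
          if ¬ ℓ ∣ a then X ^ (a + a) else 0)) := by
  have hcard := sum_restricted_ite_le_parts (ℓ := ℓ) n
  generalize (PowerSeries.mk fun n =>
    ((Nat.Partition.restricted n (¬ ℓ ∣ ·)).card : ℚ)) = R at hcard ⊢
  have h1 := hcard {a}
  have h2 := hcard {a, a - 1}
  have h3 := hcard {a, a}
  simp only [Multiset.insert_eq_cons, Multiset.mem_cons, Multiset.mem_singleton, forall_eq_or_imp,
    forall_eq, Multiset.sum_cons, Multiset.sum_singleton, and_self] at h1 h2 h3 ⊢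
  rw [Finset.sum_add_distrib, h3, mul_add, map_add]
  congr 1
  · by_cases ha : 2 ≤ a
    · simp only [if_pos ha]
      rw [Finset.sum_sub_distrib, h1, h2, mul_sub, map_sub]
      simp only [mul_ite, apply_ite (coeff n), mul_zero, map_zero]
    · simp only [if_neg ha, Finset.sum_const_zero, mul_zero, map_zero]
  · simp only [mul_ite, apply_ite (coeff n), mul_zero, map_zero]

/-- The generating function of the total number of hooks of length two, in terms of that of
`ℓ`-regular partitions. -/
theorem mk_bCount_two_eq_mk_card_restricted_mul {ℓ : ℕ} (hℓ : 2 ≤ ℓ) :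
    (PowerSeries.mk fun n => (bCount ℓ 2 n : ℚ)) =
      (PowerSeries.mk fun n => ((Nat.Partition.restricted n (¬ ℓ ∣ ·)).card : ℚ)) *
        (2 * X ^ 2 * (1 - (X : ℚ⟦X⟧) ^ 2)⁻¹ - X ^ ℓ * (1 - (X : ℚ⟦X⟧) ^ ℓ)⁻¹ +
          (X ^ (2 * ℓ - 1) - X ^ (2 * ℓ) + X ^ (2 * ℓ + 1)) *
            (1 - (X : ℚ⟦X⟧) ^ (2 * ℓ))⁻¹) := by
  ext n
  rw [coeff_mk]
  have hb : (bCount ℓ 2 n : ℚ) =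
      ∑ p ∈ Nat.Partition.restricted n (¬ ℓ ∣ ·), (hookCount p 2 : ℚ) := by
    rw [bCount, Nat.cast_sum]
    rfl
  have hcoeff : ∀ f g : ℚ⟦X⟧, (∀ m ≤ n, coeff m f = coeff m g) → ∀ r : ℚ⟦X⟧,
      coeff n (r * f) = coeff n (r * g) := fun f g h r => by
    rw [coeff_mul, coeff_mul]
    exact Finset.sum_congr rfl fun ij hij => by
      rw [h _ (by rw [Finset.HasAntidiagonal.mem_antidiagonal] at hij; omega)]
  rw [← hcoeff _ _ fun m hm => coeff_sum_eq_coeff_closed_form hℓ hm, hb]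
  simp only [natCast_hookCount_two]
  rw [Finset.sum_comm, Finset.mul_sum, map_sum]
  exact Finset.sum_congr rfl fun a _ => sum_restricted_ite_le_parts_eq_coeff ℓ n a

theorem bCount_two_generating_function (ℓ : ℕ) (hℓ : 2 ≤ ℓ) :
    (PowerSeries.mk fun n => (bCount ℓ 2 n : ℚ)) =
      (∏' j : ℕ, (1 - (X : ℚ⟦X⟧) ^ (ℓ * (j + 1)))) *
        (∏' j : ℕ, (1 - (X : ℚ⟦X⟧) ^ (j + 1)))⁻¹ *
        (2 * X ^ 2 * (1 - (X : ℚ⟦X⟧) ^ 2)⁻¹ - X ^ ℓ * (1 - (X : ℚ⟦X⟧) ^ ℓ)⁻¹ +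
          (X ^ (2 * ℓ - 1) - X ^ (2 * ℓ) + X ^ (2 * ℓ + 1)) *
            (1 - (X : ℚ⟦X⟧) ^ (2 * ℓ))⁻¹) := by
  have hR : (PowerSeries.mk fun n => ((Nat.Partition.restricted n (¬ ℓ ∣ ·)).card : ℚ)) =
      (∏' j : ℕ, (1 - (X : ℚ⟦X⟧) ^ (ℓ * (j + 1)))) *
        (∏' j : ℕ, (1 - (X : ℚ⟦X⟧) ^ (j + 1)))⁻¹ :=
    mk_card_restricted_not_dvd_eq_tprod_mul_inv ℚ (by omega)
  rw [mk_bCount_two_eq_mk_card_restricted_mul hℓ, hR]
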